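/- If N_{μ,ν,λ} > 0 and |λ| < |μ| + |ν|, then there exists a partition λ'' ⊃ λ with |λ''| = |λ| + 2 such that N_{μ,ν,λ''} > 0. -/

import Mathlib

open YoungDiagram

/-- An LR (Littlewood–Richardson) filling witnessing the Littlewood–Richardson
coefficient `c^lam_{μ,ν}`: a ballot (lattice-word) semistandard filling of the skew
shape `lam/μ` with content `ν`.  The entry in row `i`, column `j` is `T i j`;
entries are `≥ 1` on the cells of `lam/μ` and `0` elsewhere. -/
structure LRFilling (μ ν lam : YoungDiagram) : Type where
  sub : μ ≤ lam
  T : ℕ → ℕ → ℕ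
  supp : ∀ i j, T i j ≠ 0 ↔ ((i, j) ∈ lam ∧ (i, j) ∉ μ)
  rows_weak : ∀ i j₁ j₂, j₁ ≤ j₂ → T i j₁ ≠ 0 → T i j₂ ≠ 0 → T i j₁ ≤ T i j₂
  cols_strict : ∀ i₁ i₂ j, i₁ < i₂ → T i₁ j ≠ 0 → T i₂ j ≠ 0 → T i₁ j < T i₂ j
  content : ∀ k : ℕ, Nat.card {p : ℕ × ℕ // T p.1 p.2 = k + 1} = ν.rowLen k
  ballot : ∀ i j k : ℕ,
    Nat.card {p : ℕ × ℕ // (p.1 < i ∨ (p.1 = i ∧ j ≤ p.2)) ∧ T p.1 p.2 = k + 2} ≤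
      Nat.card {p : ℕ × ℕ // (p.1 < i ∨ (p.1 = i ∧ j ≤ p.2)) ∧ T p.1 p.2 = k + 1}

/-- The Littlewood–Richardson coefficient `c^lam_{μ,ν}`. -/
noncomputable def lrCoeff (μ ν lam : YoungDiagram) : ℕ := Nat.card (LRFilling μ ν lam)

/-- The Newell–Littlewood number
`N_{μ,ν,lam} = Σ_{α,β,γ} c^μ_{α,β} c^ν_{α,γ} c^lam_{β,γ}`,
realized as the cardinality of the set of triples of LR fillings over all `α,β,γ`. -/
noncomputable def NL (μ ν lam : YoungDiagram) : ℕ :=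
  Nat.card (Σ α β γ : YoungDiagram,
    (LRFilling α β μ × LRFilling α γ ν × LRFilling β γ lam))


open Classical in
noncomputable def ind (p : Prop) : ℤ := if p then 1 else 0

lemma ind_true {p : Prop} (h : p) : ind p = 1 := by simp [ind, h]
lemma ind_false {p : Prop} (h : ¬ p) : ind p = 0 := by simp [ind, h]
lemma ind_nonneg (p : Prop) : 0 ≤ ind p := by unfold ind; split_ifs <;> simp
lemma ind_le_one (p : Prop) : ind p ≤ 1 := by unfold ind; split_ifs <;> simp
lemma ind_not (p : Prop) : ind (¬ p) = 1 - ind p := by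
  by_cases h : p <;> simp [ind, h]
lemma ind_le {p q : Prop} (h : p → q) : ind p ≤ ind q := by
  by_cases hp : p
  · rw [ind_true hp, ind_true (h hp)]
  · rw [ind_false hp]; exact ind_nonneg q

/-- indicator of a single row -/
def dlt (r : ℕ) (i : ℕ) : ℤ := if i = r then 1 else 0

lemma exists_drop (p : ℕ → Prop) (hp : ∀ n, p (n + 1) → p n) (h0 : p 0) (M : ℕ) (hM : ¬ p M) :
    ∃ e, ∀ n, ind (p n) - ind (p (n + 1)) = dlt e n := by
  classical
  have hex : ∃ m, ¬ p m := ⟨M, hM⟩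
  have hanti : ∀ m n, m ≤ n → p n → p m := by
    intro m n hmn
    induction hmn with
    | refl => exact id
    | step _ ih => exact fun h => ih (hp _ h)
  obtain ⟨e, he⟩ : ∃ e, Nat.find hex = e + 1 := by
    rcases hh : Nat.find hex with _ | e
    · exact absurd h0 (hh ▸ Nat.find_spec hex)
    · exact ⟨e, rfl⟩
  have hlt : ∀ n, n ≤ e → p n := by
    intro n hn
    by_contra hc
    have := Nat.find_min' hex hc
    omega
  have hge : ∀ n, e + 1 ≤ n → ¬ p n := by
    intro n hn hc
    have := Nat.find_spec hex
    rw [he] at this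
    exact this (hanti _ _ hn hc)
  refine ⟨e, fun n => ?_⟩
  unfold dlt
  rcases lt_trichotomy n e with h | h | h
  · rw [ind_true (hlt n h.le), ind_true (hlt (n + 1) h), if_neg h.ne]; rfl
  · rw [ind_true (hlt n h.le), ind_false (hge (n + 1) (by omega)), if_pos h]; rfl
  · rw [ind_false (hge n h), ind_false (hge (n + 1) (by omega)), if_neg h.ne']; rfl

/-- number of letters `k+1` in the first `n` rows -/
def NN (L : ℕ → ℕ → ℤ) (n k : ℕ) : ℤ := ∑ i ∈ Finset.range n, (L i (k + 1) - L i k)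

lemma NN_succ (L : ℕ → ℕ → ℤ) (n k : ℕ) : NN L (n + 1) k = NN L n k + (L n (k + 1) - L n k) := by
  unfold NN; rw [Finset.sum_range_succ]

/-- Gelfand-Tsetlin style encoding of LR fillings: `L i k` is the number of cells in row `i`
with entry at most `k` (including the inner shape). -/
structure LRD (a c l : ℕ → ℤ) (L : ℕ → ℕ → ℤ) : Prop where
  zero : ∀ i, L i 0 = a i
  mono : ∀ i k, L i k ≤ L i (k + 1)
  inter : ∀ i k, L (i + 1) (k + 1) ≤ L i k
  top : ∃ K, ∀ i k, K ≤ k → L i k = l i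
  bal : ∀ n k, NN L (n + 1) (k + 1) ≤ NN L n k
  cont : ∃ R, ∀ n k, R ≤ n → NN L n k = c k

lemma LRD.mono' {a c l L} (h : LRD a c l L) (i : ℕ) {k k' : ℕ} (hk : k ≤ k') : L i k ≤ L i k' :=
  monotone_nat_of_le_succ (h.mono i) hk

/-- The change of `NN` under an increment which telescopes. -/
lemma NN_add (L : ℕ → ℕ → ℤ) (f : ℕ → ℕ → ℤ) (n k : ℕ) :
    NN (fun i k => L i k + (f (i + 1) k - f i k)) n k
      = NN L n k + (f n (k + 1) - f 0 (k + 1)) - (f n k - f 0 k) := by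
  induction n with
  | zero => simp [NN]
  | succ n ih => rw [NN_succ, NN_succ, ih]; ring

/-! ### Enlarging the inner shape -/

def U2 (L : ℕ → ℕ → ℤ) (r : ℕ) : ℕ → ℕ → Prop
  | 0, _ => True
  | i + 1, k => i < r ∨ ∃ x, U2 L r i x ∧ L i x < L i k

lemma up2 {a c l L} (h : LRD a c l L) (r : ℕ) (hr : ∀ i, i + 1 = r → a r < a i) :
    ∃ L' e, LRD (a + dlt r) c (l + dlt e) L' := by
  obtain ⟨K, hK⟩ := h.top
  obtain ⟨R, hR⟩ := h.cont
  set U := U2 L r with hU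
  have U0 : ∀ k, U 0 k := fun k => by rw [hU]; simp [U2]
  have Us : ∀ i k, U (i + 1) k ↔ (i < r ∨ ∃ x, U i x ∧ L i x < L i k) := fun i k => by
    rw [hU]; simp [U2]
  have Ule : ∀ i k, i ≤ r → U i k := by
    intro i k hi
    rcases i with _ | i
    · exact U0 k
    · exact (Us i k).2 (Or.inl (by omega))
  have Uup : ∀ i k k', k ≤ k' → U i k → U i k' := by
    intro i k k' hk hu
    rcases i with _ | i
    · exact U0 _
    · rcases (Us i k).1 hu with hi | ⟨x, hx, hlt⟩
      · exact (Us i k').2 (Or.inl hi)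
      · exact (Us i k').2 (Or.inr ⟨x, hx, hlt.trans_le (h.mono' i hk)⟩)
  have Udown : ∀ i k, U (i + 1) k → U i k := by
    intro i k hu
    rcases (Us i k).1 hu with hi | ⟨x, hx, hlt⟩
    · exact Ule i k hi.le
    · refine Uup i x k ?_ hx
      by_contra hc
      exact absurd (h.mono' i (not_le.1 hc).le) (not_le.2 hlt)
  -- elements removed at step `i` are the minimal ones
  have Umin : ∀ i k x, ¬ U (i + 1) k → U i x → L i k ≤ L i x := by
    intro i k x hn hx
    by_contra hc
    exact hn ((Us i k).2 (Or.inr ⟨x, hx, not_le.1 hc⟩))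
  have Unr : ∀ i k, ¬ U (i + 1) k → r ≤ i := by
    intro i k hn
    by_contra hc
    exact hn (Ule _ _ (by omega))
  have Ustep : ∀ i k, r ≤ i → U (i + 1) (k + 1) → ¬ U (i + 1) k → U i k ∧ L i k < L i (k + 1) := by
    intro i k hi h1 h2
    rcases (Us i _).1 h1 with h3 | ⟨x, hx, hlt⟩
    · omega
    · have hxk : x ≤ k := by
        by_contra hc
        exact absurd (h.mono' i (show k + 1 ≤ x by omega)) (not_le.2 hlt)
      exact ⟨Uup i x k hxk hx, (Umin i k x h2 hx).trans_lt hlt⟩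
  have Usize : ∀ i k, U (r + i) k → i ≤ k := by
    intro i
    induction i with
    | zero => intros; omega
    | succ i ih =>
      intro k hu
      rcases (Us (r + i) k).1 hu with h3 | ⟨x, hx, hlt⟩
      · omega
      · have := ih x hx
        by_contra hc
        exact absurd (h.mono' (r + i) (show k ≤ x by omega)) (not_le.2 hlt)
  have Uempty : ∀ n k, r + K + 1 ≤ n → ¬ U n k := by
    intro n k hn hu
    obtain ⟨i, rfl⟩ : ∃ i, n = r + i + 1 := ⟨n - r - 1, by omega⟩
    rcases (Us (r + i) k).1 hu with h3 | ⟨x, hx, hlt⟩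
    · omega
    · have hxK := Usize i x hx
      have hkK : K ≤ k := by
        by_contra hc
        exact absurd (h.mono' (r + i) (show k ≤ x by omega)) (not_le.2 hlt)
      rw [hK _ x (by omega), hK _ k hkK] at hlt
      exact lt_irrefl _ hlt
  have Utop : ∀ i k, K ≤ k → (U i k ↔ U i K) := by
    intro i k hk
    refine ⟨?_, Uup i K k hk⟩
    rcases i with _ | i
    · exact fun _ => U0 _
    · rw [Us, Us, hK i k hk, hK i K le_rfl]; exact id
  obtain ⟨e, he⟩ := exists_drop (fun n => U n K) (fun n => Udown n K) (U0 K) (r + K + 1)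
    (Uempty _ _ le_rfl)
  set f : ℕ → ℕ → ℤ := fun n k => 1 - ind (U n k) with hf
  refine ⟨fun i k => L i k + (f (i + 1) k - f i k), e, ?_, ?_, ?_, ?_, ?_, ?_⟩
  · intro i
    simp only [hf, h.zero, Pi.add_apply, dlt]
    rcases lt_trichotomy i r with hi | hi | hi
    · rw [ind_true (Ule i 0 hi.le), ind_true (Ule (i + 1) 0 hi), if_neg hi.ne]; ring
    · subst hi
      rw [ind_true (Ule i 0 le_rfl), ind_false, if_pos rfl]; · ring
      intro hu
      have := Usize 1 0 hu
      omega
    · rw [ind_false, ind_false, if_neg hi.ne']; · ring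
      · intro hu
        have := Usize (i - r) 0 (by rwa [Nat.add_sub_cancel' hi.le])
        omega
      · intro hu
        have := Usize (i + 1 - r) 0 (by rwa [Nat.add_sub_cancel' (by omega)])
        omega
  · intro i k
    simp only [hf]
    have hm := h.mono i k
    have u1 := ind_le (Udown i k)
    have u2 := ind_le (Udown i (k + 1))
    by_cases h1 : U i k
    · have h1' := Uup i k (k + 1) (by omega) h1
      by_cases h2 : U (i + 1) k
      · have h2' := Uup (i + 1) k (k + 1) (by omega) h2
        rw [ind_true h1, ind_true h1', ind_true h2, ind_true h2']; omega
      · by_cases h3 : U (i + 1) (k + 1)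
        · have := (Ustep i k (Unr i k h2) h3 h2).2
          rw [ind_true h1, ind_true h1', ind_false h2, ind_true h3]; omega
        · rw [ind_true h1, ind_true h1', ind_false h2, ind_false h3]; omega
    · have h2 : ¬ U (i + 1) k := fun hh => h1 (Udown i k hh)
      rw [ind_false h1, ind_false h2]
      omega
  · intro i k
    simp only [hf]
    have hm := h.inter i k
    have u1 := ind_le (Udown i k)
    by_cases h1 : U (i + 1) (k + 1) ∧ ¬ U (i + 1 + 1) (k + 1)
    · obtain ⟨h1, h2⟩ := h1
      rw [ind_true h1, ind_false h2]
      have hri : r ≤ i + 1 := Unr _ _ h2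
      by_cases h3 : U (i + 1) k
      · rw [ind_true h3, ind_true (Udown i k h3)]
        have key : L (i + 1) (k + 1) < L i k := by
          rcases Nat.lt_or_ge i r with hir | hir
          · have hr' : i + 1 = r := by omega
            have e1 := hr i hr'
            have e2 := Umin (i + 1) (k + 1) 0 h2 (Ule _ _ (by omega))
            rw [h.zero, hr'] at e2
            rw [← hr'] at e2 e1
            have e3 := h.mono' i (Nat.zero_le k)
            rw [h.zero] at e3
            omega
          · classical
            have hex : ∃ z, U (i + 1) z := ⟨k, h3⟩
            have hz := Nat.find_spec hex
            have hzk := Nat.find_min' hex h3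
            have hzmin := fun m => Nat.find_min hex (m := m)
            rcases hzz : Nat.find hex with _ | z
            · rw [hzz] at hz
              have := Usize (i + 1 - r) 0 (by rwa [Nat.add_sub_cancel' (by omega)])
              omega
            · rw [hzz] at hz hzk hzmin
              have e1 := (Ustep i z hir hz (hzmin z (by omega))).2
              have e2 := Umin (i + 1) (k + 1) (z + 1) h2 hz
              have e3 := h.inter i z
              have e4 := h.mono' i hzk
              omega
        omega
      · rw [ind_false h3]
        have : U i k := by
          rcases Nat.lt_or_ge i r with hir | hir
          · exact Ule _ _ hir.le
          · exact (Ustep i k hir h1 h3).1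
        rw [ind_true this]
        omega
    · have : ind (U (i + 1) (k + 1)) ≤ ind (U (i + 1 + 1) (k + 1)) := by
        apply ind_le
        intro h3
        by_contra h4
        exact h1 ⟨h3, h4⟩
      omega
  · refine ⟨K, fun i k hk => ?_⟩
    simp only [hf, Pi.add_apply, ← he, hK i k hk]
    rw [show U i k = U i K from propext (Utop i k hk),
      show U (i + 1) k = U (i + 1) K from propext (Utop (i + 1) k hk)]
    ring
  · intro n k
    rw [NN_add, NN_add]
    simp only [hf, ind_true (U0 _)]
    have hb := h.bal n k
    have u1 := ind_le (Uup (n + 1) (k + 1) (k + 1 + 1) (by omega))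
    by_cases h1 : U n (k + 1) ∧ ¬ U n k
    · obtain ⟨h1, h2⟩ := h1
      rw [ind_true h1, ind_false h2]
      rcases n with _ | m
      · exact absurd (U0 k) h2
      have hm := Unr m k h2
      have h3 : ¬ U (m + 1 + 1) (k + 1) := by
        intro h4
        rcases (Us (m + 1) (k + 1)).1 h4 with h5 | ⟨x, hx, hlt⟩
        · omega
        · have : x ≤ k := by
            by_contra hc
            exact absurd (h.mono' (m + 1) (show k + 1 ≤ x by omega)) (not_le.2 hlt)
          exact h2 (Uup _ _ _ this hx)
      rw [ind_false h3]
      by_cases h4 : U (m + 1 + 1) (k + 1 + 1)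
      · rw [ind_true h4]; omega
      · rw [ind_false h4]
        have e1 := Umin (m + 1) (k + 1 + 1) (k + 1) h4 h1
        have e2 := (Ustep m k hm h1 h2).2
        have e3 := h.bal m k
        have e4 := NN_succ L (m + 1) (k + 1)
        have e5 := NN_succ L m k
        omega
    · have : ind (U n (k + 1)) ≤ ind (U n k) := by
        apply ind_le
        intro h3
        by_contra h4
        exact h1 ⟨h3, h4⟩
      omega
  · refine ⟨max R (r + K + 1), fun n k hn => ?_⟩
    rw [NN_add]
    simp only [hf, ind_true (U0 _), ind_false (Uempty n _ (le_trans (le_max_right _ _) hn)),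
      hR n k (le_trans (le_max_left _ _) hn)]
    ring

/-! ### Enlarging the content -/

inductive V3 (L : ℕ → ℕ → ℤ) (R x : ℕ) : ℕ → ℕ → Prop
  | base (n k : ℕ) : R ≤ n → x + 1 ≤ k → V3 L R x n k
  | step (n y k : ℕ) : V3 L R x (n + 2) (y + 1) → y + 1 ≤ k → L (n + 1) (y + 1) = L n y →
      V3 L R x (n + 1) k

lemma up3 {a c l L} (h : LRD a c l L) (x : ℕ) (hx : ∀ y, y + 1 = x → c x < c y) :
    ∃ L' e, LRD a (c + dlt x) (l + dlt e) L' := by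
  obtain ⟨K₀, hK₀⟩ := h.top
  obtain ⟨R₀, hR₀⟩ := h.cont
  obtain ⟨R, hRR⟩ : ∃ R, R = R₀ + 2 := ⟨_, rfl⟩
  have hR : ∀ n k, R ≤ n + 1 → NN L n k = c k := fun n k hn => hR₀ n k (by omega)
  obtain ⟨K, hKx, hK⟩ : ∃ K, x + 1 ≤ K ∧ ∀ i k, K ≤ k → L i k = l i :=
    ⟨max K₀ (x + 1), le_max_right _ _, fun i k hk => hK₀ i k (le_trans (le_max_left _ _) hk)⟩
  set V := V3 L R x with hV
  have V0 : ∀ k, ¬ V 0 k := by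
    intro k hk
    cases hk with
    | base _ _ h1 h2 => omega
  have Vbase : ∀ n k, R ≤ n → (V n k ↔ x + 1 ≤ k) := by
    intro n k hn
    refine ⟨fun hv => ?_, fun hk => V3.base n k hn hk⟩
    have gen : ∀ n k, V n k → x + 1 ≤ k := by
      intro n k hv
      induction hv with
      | base n k h1 h2 => exact h2
      | step n y k h1 h2 h3 ih => omega
    exact gen n k hv
  have Vpos : ∀ n k, V n k → x + 1 ≤ k := by
    intro n k hv
    induction hv with
    | base n k h1 h2 => exact h2
    | step n y k h1 h2 h3 ih => omega
  have Vup : ∀ n k k', k ≤ k' → V n k → V n k' := by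
    intro n k k' hk hv
    cases hv with
    | base _ _ h1 h2 => exact V3.base _ _ h1 (by omega)
    | step n y _ h1 h2 h3 => exact V3.step n y _ h1 (by omega) h3
  have Vs : ∀ n k, n + 1 < R → V (n + 1) k → ∃ y, y + 1 ≤ k ∧ V (n + 2) (y + 1) ∧
      L (n + 1) (y + 1) = L n y := by
    intro n k hn hv
    cases hv with
    | base _ _ h1 h2 => omega
    | step n y _ h1 h2 h3 => exact ⟨y, h2, h1, h3⟩
  have Vdown : ∀ n k, V n k → V (n + 1) k := by
    intro n k hv
    cases hv with
    | base _ _ h1 h2 => exact V3.base _ _ (by omega) h2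
    | step n y _ h1 h2 h3 => exact Vup _ _ _ h2 h1
  have Vnt : ∀ n k, V (n + 2) (k + 1) → ¬ V (n + 1) (k + 1) → L (n + 1) (k + 1) < L n k := by
    intro n k h1 h2
    refine lt_of_le_of_ne (h.inter n k) fun h3 => h2 (V3.step n k _ h1 le_rfl h3)
  have VR : ∀ n k, V (n + 1) k → ¬ V n k → n < R := by
    intro n k h1 h2
    by_contra hc
    exact h2 (V3.base _ _ (by omega) (Vpos _ _ h1))
  have Vstep : ∀ n k, n + 1 < R → V (n + 1) (k + 1) → ¬ V (n + 1) k →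
      V (n + 2) (k + 1) ∧ L (n + 1) (k + 1) = L n k := by
    intro n k hn h1 h2
    obtain ⟨y, hy, hy1, hy2⟩ := Vs n _ hn h1
    have : y = k := by
      by_contra hne
      exact h2 (V3.step n y k hy1 (by omega) hy2)
    subst this
    exact ⟨hy1, hy2⟩
  have Vtop : ∀ n k, V n k → V n K := by
    intro n k hv
    induction hv with
    | base n k h1 h2 => exact V3.base _ _ h1 hKx
    | step n y k h1 h2 h3 ih =>
      rcases Nat.lt_or_ge K (y + 1) with hy | hy
      · obtain ⟨K', rfl⟩ : ∃ K', K = K' + 1 := ⟨K - 1, by omega⟩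
        refine V3.step n K' _ ih le_rfl ?_
        have e1 := h.inter n K'
        have e2 := h.mono' n (show K' ≤ y by omega)
        have e3 := hK (n + 1) (K' + 1) le_rfl
        have e4 := hK (n + 1) (y + 1) (by omega)
        omega
      · exact V3.step n y K h1 hy h3
  have Vtop' : ∀ n k, K ≤ k → (V n k ↔ V n K) := fun n k hk =>
    ⟨Vtop n k, Vup n K k hk⟩
  have Vbal : ∀ t n k, n + 1 + t = R ∨ R ≤ n + 1 → V (n + 1) (k + 2) → ¬ V (n + 1) (k + 1) →
      NN L (n + 1) (k + 1) < NN L n k := by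
    intro t
    have big : ∀ n k, R ≤ n + 1 → V (n + 1) (k + 2) → ¬ V (n + 1) (k + 1) →
      NN L (n + 1) (k + 1) < NN L n k := by
      intro n k hn h1 h2
      rw [Vbase _ _ hn] at h1 h2
      rw [hR n k hn, hR (n + 1) (k + 1) (by omega)]
      have : k + 1 = x := by omega
      rw [this]
      exact hx k this
    induction t with
    | zero =>
      intro n k hn
      exact big n k (by omega)
    | succ t ih =>
      intro n k hn h1 h2
      rcases Nat.lt_or_ge (n + 1) R with hnR | hnR
      · obtain ⟨e1, e2⟩ := Vstep n (k + 1) hnR h1 h2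
        have s1 := NN_succ L (n + 1) (k + 1)
        have s2 := NN_succ L n k
        by_cases h3 : V (n + 2) (k + 1)
        · have e3 := Vnt n k h3 h2
          have e4 := h.bal (n + 1) k
          simp only [Nat.add_assoc, Nat.reduceAdd] at *
          omega
        · have e3 := ih (n + 1) k (by omega) e1 h3
          have e4 := h.inter n k
          simp only [Nat.add_assoc, Nat.reduceAdd] at *
          omega
      · exact big n k hnR h1 h2
  obtain ⟨e, he⟩ := exists_drop (fun n => ¬ V n K) (fun n h1 h2 => h1 (Vdown n K h2)) (V0 K) R
    (fun h1 => h1 (V3.base _ _ le_rfl hKx))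
  simp only [ind_not] at he
  set f : ℕ → ℕ → ℤ := fun n k => ind (V n k) with hf
  refine ⟨fun i k => L i k + (f (i + 1) k - f i k), e, ?_, ?_, ?_, ?_, ?_, ?_⟩
  · intro i
    simp only [hf, h.zero]
    rw [ind_false, ind_false]
    · ring
    · intro hv; have := Vpos _ _ hv; omega
    · intro hv; have := Vpos _ _ hv; omega
  · intro i k
    simp only [hf]
    have hm := h.mono i k
    have u2 := ind_le (Vdown i (k + 1))
    by_cases h1 : V (i + 1) k ∧ ¬ V i k
    · obtain ⟨h1, h2⟩ := h1
      rw [ind_true h1, ind_false h2, ind_true (Vup _ k (k + 1) (by omega) h1)]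
      by_cases h3 : V i (k + 1)
      · rw [ind_true h3]
        rcases i with _ | i
        · exact absurd h3 (V0 _)
        have hiR := VR _ _ h1 h2
        obtain ⟨e1, e2⟩ := Vstep i k hiR h3 h2
        rcases k with _ | k
        · have := Vpos _ _ h1; omega
        have e3 := Vnt i k h1 h2
        have e4 := h.mono i k
        omega
      · rw [ind_false h3]; omega
    · have : ind (V (i + 1) k) ≤ ind (V i k) := by
        apply ind_le
        intro h3
        by_contra h4
        exact h1 ⟨h3, h4⟩
      omega
  · intro i k
    simp only [hf]
    have hm := h.inter i k
    have u1 := ind_le (Vdown i k)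
    by_cases h1 : V (i + 1 + 1) (k + 1) ∧ ¬ V (i + 1) (k + 1)
    · obtain ⟨h1, h2⟩ := h1
      have := Vnt i k h1 h2
      rw [ind_true h1, ind_false h2]
      omega
    · have : ind (V (i + 1 + 1) (k + 1)) ≤ ind (V (i + 1) (k + 1)) := by
        apply ind_le
        intro h3
        by_contra h4
        exact h1 ⟨h3, h4⟩
      omega
  · refine ⟨K, fun i k hk => ?_⟩
    simp only [hf, Pi.add_apply, ← he, hK i k hk]
    rw [show V i k = V i K from propext (Vtop' i k hk),
      show V (i + 1) k = V (i + 1) K from propext (Vtop' (i + 1) k hk)]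
    ring
  · intro n k
    rw [NN_add, NN_add]
    simp only [hf, ind_false (V0 _)]
    have hb := h.bal n k
    have u1 := ind_le (Vup n k (k + 1) (by omega))
    by_cases h1 : V (n + 1) (k + 1 + 1) ∧ ¬ V (n + 1) (k + 1)
    · obtain ⟨h1, h2⟩ := h1
      rw [ind_true h1, ind_false h2]
      have := Vbal (R - (n + 1)) n k (by omega) h1 h2
      omega
    · have : ind (V (n + 1) (k + 1 + 1)) ≤ ind (V (n + 1) (k + 1)) := by
        apply ind_le
        intro h3
        by_contra h4
        exact h1 ⟨h3, h4⟩
      omega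
  · refine ⟨R, fun n k hn => ?_⟩
    rw [NN_add, hR n k (by omega)]
    simp only [hf, ind_false (V0 _), Pi.add_apply, dlt]
    rw [show V n (k + 1) = (x + 1 ≤ k + 1) from propext (Vbase n _ hn),
      show V n k = (x + 1 ≤ k) from propext (Vbase n _ hn)]
    unfold ind
    split_ifs <;> omega

/-! ### Shrinking the inner shape -/

def P1 (L : ℕ → ℕ → ℤ) (r : ℕ) : ℕ → ℕ → Prop
  | 0, n => r < n
  | k + 1, n => ∃ m, m + 1 < n ∧ P1 L r k (m + 1) ∧
      ((∃ k', k = k' + 1 ∧ NN L (m + 2) k = NN L (m + 1) k') ∨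
        (¬ P1 L r k m ∧ L (m + 1) (k + 1) = L m k))

lemma down1 {a c l L} (h : LRD a c l L) (r : ℕ) (hr : a (r + 1) < a r)
    (hl : ∃ R, ∀ i, R ≤ i → l i = 0) (ha : ∀ i, 0 ≤ a i) :
    ∃ L' e, LRD (a - dlt r) (c + dlt e) l L' := by
  obtain ⟨K, hK⟩ := h.top
  obtain ⟨R₀, hR₀⟩ := h.cont
  obtain ⟨R₁, hR₁⟩ := hl
  obtain ⟨R, hrR, hR, hRl⟩ : ∃ R, r < R ∧ (∀ n k, R ≤ n → NN L n k = c k) ∧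
      ∀ i, R ≤ i → l i = 0 :=
    ⟨R₀ + R₁ + r + 1, by omega, fun n k hn => hR₀ n k (by omega), fun i hi => hR₁ i (by omega)⟩
  set P := P1 L r with hP
  have P0 : ∀ n, P 0 n ↔ r < n := fun n => by rw [hP]; simp [P1]
  have Ps : ∀ k n, P (k + 1) n ↔ ∃ m, m + 1 < n ∧ P k (m + 1) ∧
      ((∃ k', k = k' + 1 ∧ NN L (m + 2) k = NN L (m + 1) k') ∨
        (¬ P k m ∧ L (m + 1) (k + 1) = L m k)) := fun k n => by
    rw [hP]; simp only [P1]
  have Pup : ∀ k n n', n ≤ n' → P k n → P k n' := by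
    intro k n n' hn hp
    rcases k with _ | k
    · rw [P0] at *; omega
    · obtain ⟨m, hm, hm'⟩ := (Ps k n).1 hp
      exact (Ps k n').2 ⟨m, by omega, hm'⟩
  have Pz : ∀ k, ¬ P k 0 := by
    intro k hp
    rcases k with _ | k
    · rw [P0] at hp; omega
    · obtain ⟨m, hm, hm'⟩ := (Ps k 0).1 hp
      omega
  have Pdown : ∀ k n, P (k + 1) (n + 1) → P k n := by
    intro k n hp
    obtain ⟨m, hm, hm', _⟩ := (Ps k _).1 hp
    exact Pup k (m + 1) n (by omega) hm'
  have Pdown' : ∀ k n, P (k + 1) n → P k n := by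
    intro k n hp
    exact Pdown k n (Pup _ _ _ (by omega) hp)
  -- the corner of `P (k+1)`
  have Pcorner : ∀ k i, P (k + 1) (i + 1) → ¬ P (k + 1) i → ∃ m, i = m + 1 ∧ P k (m + 1) ∧
      ((∃ k', k = k' + 1 ∧ NN L (m + 2) k = NN L (m + 1) k') ∨
        (¬ P k m ∧ L (m + 1) (k + 1) = L m k)) := by
    intro k i h1 h2
    obtain ⟨m, hm, hm'⟩ := (Ps k _).1 h1
    have : i = m + 1 := by
      by_contra hne
      exact h2 ((Ps k i).2 ⟨m, by omega, hm'⟩)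
    exact ⟨m, this, hm'⟩
  have Pbal : ∀ k m, P (k + 1) (m + 1) → ¬ P (k + 2) (m + 2) →
      NN L (m + 2) (k + 1) < NN L (m + 1) k := by
    intro k m h1 h2
    refine lt_of_le_of_ne (h.bal (m + 1) k) fun h3 => h2 ((Ps _ _).2 ⟨m, by omega, h1, Or.inl ?_⟩)
    exact ⟨k, rfl, h3⟩
  have inv : ∀ k i, P (k + 1) (i + 1) → ¬ P (k + 1) i → L i k < L i (k + 1) := by
    intro k
    induction k with
    | zero =>
      intro i h1 h2
      obtain ⟨m, rfl, hm, hh⟩ := Pcorner _ _ h1 h2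
      rcases hh with ⟨k', hk', _⟩ | ⟨hm2, heq⟩
      · omega
      · rw [P0] at hm hm2
        have : m = r := by omega
        subst this
        rw [heq, h.zero, h.zero]
        exact hr
    | succ k ih =>
      intro i h1 h2
      obtain ⟨m, rfl, hm, hh⟩ := Pcorner _ _ h1 h2
      rcases hh with ⟨k', hk', heq⟩ | ⟨hm2, heq⟩
      · obtain rfl : k = k' := by omega
        have s1 := NN_succ L (m + 1) (k + 1)
        have s2 := NN_succ L m k
        have key : NN L (m + 1) (k + 1) < NN L (m + 1) k := by
          by_cases hm2 : P (k + 1) m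
          · rcases m with _ | m
            · exact absurd hm2 (Pz _)
            have := Pbal k m hm2 h2
            have := h.mono (m + 1) k
            simp only [Nat.add_assoc, Nat.reduceAdd] at *
            omega
          · have := ih m hm hm2
            have := h.bal m k
            omega
        simp only [Nat.add_assoc, Nat.reduceAdd] at *
        omega
      · have e1 := ih m hm hm2
        have e2 := h.inter m k
        omega
  have exmin : ∀ k n, P k n → ∃ i, i < n ∧ P k (i + 1) ∧ ¬ P k i := by
    intro k n
    induction n with
    | zero => intro hp; exact absurd hp (Pz k)
    | succ n ih =>
      intro hp
      by_cases hn : P k n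
      · obtain ⟨i, hi, hi'⟩ := ih hn
        exact ⟨i, by omega, hi'⟩
      · exact ⟨n, by omega, hp, hn⟩
  have Pempty : ∀ k n, K ≤ k → ¬ P (k + 1) n := by
    intro k n hk hp
    obtain ⟨i, _, h1, h2⟩ := exmin _ _ hp
    have := inv k i h1 h2
    rw [hK i k hk, hK i (k + 1) (by omega)] at this
    exact lt_irrefl _ this
  have Lle : ∀ i k, L i k ≤ l i := by
    intro i k
    rw [← hK i (max K k) (le_max_left _ _)]
    exact h.mono' i (le_max_right _ _)
  have Lnn : ∀ i k, 0 ≤ L i k := by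
    intro i k
    have := h.mono' i (Nat.zero_le k)
    rw [h.zero] at this
    exact (ha i).trans this
  have Pstab : ∀ k n, R ≤ n → (P k n ↔ P k R) := by
    intro k n hn
    refine ⟨fun hp => ?_, Pup k R n hn⟩
    rcases k with _ | k
    · rw [P0]; exact hrR
    · obtain ⟨i, _, h1, h2⟩ := exmin _ _ hp
      have e1 := inv k i h1 h2
      have e2 := Lnn i k
      have e3 := Lle i (k + 1)
      refine Pup _ (i + 1) R ?_ h1
      by_contra hc
      have := hRl i (by omega)
      omega
  obtain ⟨e, he⟩ := exists_drop (fun k => P k R) (fun k => Pdown' k R) ((P0 R).2 hrR) (K + 1)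
    (Pempty K R le_rfl)
  set f : ℕ → ℕ → ℤ := fun n k => - ind (P k n) with hf
  refine ⟨fun i k => L i k + (f (i + 1) k - f i k), e, ?_, ?_, ?_, ?_, ?_, ?_⟩
  · intro i
    simp only [hf, h.zero, Pi.sub_apply, dlt]
    rw [show P 0 (i + 1) = (r < i + 1) from propext (P0 _),
      show P 0 i = (r < i) from propext (P0 _)]
    unfold ind
    split_ifs <;> omega
  · intro i k
    simp only [hf]
    have hm := h.mono i k
    have u2 := ind_le (Pup k i (i + 1) (by omega))
    by_cases h1 : P (k + 1) (i + 1) ∧ ¬ P (k + 1) i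
    · obtain ⟨h1, h2⟩ := h1
      have := inv k i h1 h2
      rw [ind_true h1, ind_false h2]
      omega
    · have : ind (P (k + 1) (i + 1)) ≤ ind (P (k + 1) i) := by
        apply ind_le
        intro h3
        by_contra h4
        exact h1 ⟨h3, h4⟩
      omega
  · intro i k
    simp only [hf]
    have hm := h.inter i k
    have u1 := ind_le (Pup (k + 1) (i + 1) (i + 1 + 1) (by omega))
    by_cases h1 : P k (i + 1) ∧ ¬ P k i
    · obtain ⟨h1, h2⟩ := h1
      have h3 : ¬ P (k + 1) (i + 1) := fun hh => h2 (Pdown k i hh)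
      rw [ind_true h1, ind_false h2, ind_false h3]
      by_cases h4 : P (k + 1) (i + 1 + 1)
      · rw [ind_true h4]; omega
      · have : L (i + 1) (k + 1) < L i k := lt_of_le_of_ne hm fun h5 =>
          h4 ((Ps _ _).2 ⟨i, by omega, h1, Or.inr ⟨h2, h5⟩⟩)
        rw [ind_false h4]; omega
    · have : ind (P k (i + 1)) ≤ ind (P k i) := by
        apply ind_le
        intro h3
        by_contra h4
        exact h1 ⟨h3, h4⟩
      omega
  · refine ⟨K + 1, fun i k hk => ?_⟩
    obtain ⟨k, rfl⟩ : ∃ k', k = k' + 1 := ⟨k - 1, by omega⟩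
    simp only [hf, hK i (k + 1) (by omega), ind_false (Pempty k _ (by omega : K ≤ k))]
    ring
  · intro n k
    rw [NN_add, NN_add]
    simp only [hf, ind_false (Pz _)]
    have hb := h.bal n k
    have u1 := ind_le (Pdown' k n)
    by_cases h1 : P (k + 1) (n + 1) ∧ ¬ P (k + 1 + 1) (n + 1)
    · obtain ⟨h1, h2⟩ := h1
      have h3 := Pdown k n h1
      rw [ind_true h1, ind_false h2, ind_true h3]
      by_cases h4 : P (k + 1) n
      · rw [ind_true h4]
        rcases n with _ | n
        · exact absurd h4 (Pz _)
        have := Pbal k n h4 h2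
        simp only [Nat.add_assoc, Nat.reduceAdd] at *
        omega
      · rw [ind_false h4]; omega
    · have : ind (P (k + 1) (n + 1)) ≤ ind (P (k + 1 + 1) (n + 1)) := by
        apply ind_le
        intro h3
        by_contra h4
        exact h1 ⟨h3, h4⟩
      omega
  · refine ⟨R, fun n k hn => ?_⟩
    rw [NN_add, hR n k hn]
    simp only [hf, ind_false (Pz _), Pi.add_apply, ← he]
    rw [show P (k + 1) n = P (k + 1) R from propext (Pstab _ n hn),
      show P k n = P k R from propext (Pstab _ n hn)]
    ring

/-! ### Translation between fillings and the encoding -/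

/-- row lengths as integers -/
def rl (μ : YoungDiagram) (i : ℕ) : ℤ := (μ.rowLen i : ℤ)

lemma rowLen_zero_of_le (μ : YoungDiagram) {i : ℕ} (hi : μ.colLen 0 ≤ i) : μ.rowLen i = 0 := by
  by_contra hc
  have : (i, 0) ∈ μ := YoungDiagram.mem_iff_lt_rowLen.2 (Nat.pos_of_ne_zero hc)
  have := YoungDiagram.mem_iff_lt_colLen.1 this
  omega

lemma lt_colLen_of_rowLen {μ : YoungDiagram} {i : ℕ} (hi : μ.rowLen i ≠ 0) : i < μ.colLen 0 := by
  by_contra hc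
  exact hi (rowLen_zero_of_le μ (not_lt.1 hc))

lemma exists_diagram (f : ℕ → ℤ) (hf : ∀ i, f (i + 1) ≤ f i) (R : ℕ) (hR : ∀ i, R ≤ i → f i = 0) :
    ∃ μ : YoungDiagram, rl μ = f := by
  have hanti : Antitone f := antitone_nat_of_succ_le hf
  have hnn : ∀ i, 0 ≤ f i := fun i => by
    rw [← hR (max R i) (le_max_left _ _)]; exact hanti (le_max_right _ _)
  let S : Finset (ℕ × ℕ) :=
    (Finset.range R ×ˢ Finset.range (f 0).toNat).filter (fun p => (p.2 : ℤ) < f p.1)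
  have hS : ∀ i j, (i, j) ∈ S ↔ (j : ℤ) < f i := by
    intro i j
    simp only [S, Finset.mem_filter, Finset.mem_product, Finset.mem_range]
    refine ⟨fun h => h.2, fun h => ⟨⟨?_, ?_⟩, h⟩⟩
    · by_contra hc
      rw [hR i (by omega)] at h
      omega
    · have := hanti (Nat.zero_le i)
      omega
  have hlow : IsLowerSet (S : Set (ℕ × ℕ)) := by
    rintro ⟨i, j⟩ ⟨i', j'⟩ hle h
    rw [Finset.mem_coe, hS] at *
    have h1 : i' ≤ i := hle.1
    have h2 : j' ≤ j := hle.2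
    have := hanti h1
    omega
  refine ⟨⟨S, hlow⟩, ?_⟩
  funext i
  have : (YoungDiagram.mk S hlow).rowLen i = (f i).toNat := by
    apply eq_of_forall_lt_iff
    intro j
    rw [← YoungDiagram.mem_iff_lt_rowLen, YoungDiagram.mem_mk, hS]
    omega
  rw [rl, this]
  exact Int.toNat_of_nonneg (hnn i)

lemma card_fiber (T M : ℕ → ℕ → ℕ) (n k : ℕ)
    (hT : ∀ i j, T i j = k + 1 ↔ M i k ≤ j ∧ j < M i (k + 1)) (hM : ∀ i, M i k ≤ M i (k + 1)) :
    ((Nat.card {p : ℕ × ℕ // p.1 < n ∧ T p.1 p.2 = k + 1} : ℕ) : ℤ)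
      = NN (fun i k => (M i k : ℤ)) n k := by
  rw [Nat.subtype_card (((Finset.range n).sigma fun i => Finset.Ico (M i k) (M i (k + 1))).map
    (Equiv.sigmaEquivProd ℕ ℕ).toEmbedding)]
  · rw [Finset.card_map, Finset.card_sigma, NN]
    push_cast
    refine Finset.sum_congr rfl fun i _ => ?_
    rw [Nat.card_Ico, Nat.cast_sub (hM i)]
  · rintro ⟨i, j⟩
    rw [Finset.mem_map_equiv]
    simp [hT]

lemma LRFilling.finite_set {μ ν lam : YoungDiagram} (F : LRFilling μ ν lam) (k : ℕ) :
    {p : ℕ × ℕ | F.T p.1 p.2 = k + 1}.Finite := by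
  refine lam.cells.finite_toSet.subset ?_
  rintro ⟨i, j⟩ h
  have h' : F.T i j = k + 1 := h
  exact (YoungDiagram.mem_cells _).2 ((F.supp i j).1 (by omega)).1

lemma LRFilling.le_colLen {μ ν lam : YoungDiagram} (F : LRFilling μ ν lam) (i j : ℕ) :
    F.T i j ≤ ν.colLen 0 := by
  rcases hk : F.T i j with _ | k
  · omega
  · apply lt_colLen_of_rowLen
    rw [← F.content k]
    have : Finite {p : ℕ × ℕ // F.T p.1 p.2 = k + 1} := (F.finite_set k).to_subtype
    have : Nonempty {p : ℕ × ℕ // F.T p.1 p.2 = k + 1} := ⟨⟨(i, j), hk⟩⟩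
    exact Nat.card_pos.ne'

lemma exists_threshold (m : ℕ) (p : ℕ → Prop) (hp : ∀ j j', j ≤ j' → j' < m → p j' → p j) :
    ∃ c, ∀ j, j < c ↔ j < m ∧ p j := by
  classical
  have hex : ∃ j, ¬ (j < m ∧ p j) := ⟨m, by omega⟩
  refine ⟨Nat.find hex, fun j => ⟨fun h => ?_, fun h => ?_⟩⟩
  · exact not_not.1 (Nat.find_min hex h)
  · by_contra hc
    exact Nat.find_spec hex ⟨by omega, hp _ j (by omega) h.1 h.2⟩

lemma LRFilling.toLRD {μ ν lam : YoungDiagram} (F : LRFilling μ ν lam) :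
    ∃ L, LRD (rl μ) (rl ν) (rl lam) L := by
  have hsupp : ∀ i j, F.T i j ≠ 0 ↔ (j < lam.rowLen i ∧ ¬ j < μ.rowLen i) := by
    intro i j
    rw [F.supp, YoungDiagram.mem_iff_lt_rowLen, YoungDiagram.mem_iff_lt_rowLen]
  have hsub : ∀ i, μ.rowLen i ≤ lam.rowLen i := by
    intro i
    apply le_of_forall_lt
    intro j hj
    exact YoungDiagram.mem_iff_lt_rowLen.1 (F.sub (YoungDiagram.mem_iff_lt_rowLen.2 hj))
  have hM : ∀ i k, ∃ c, ∀ j, j < c ↔ j < lam.rowLen i ∧ F.T i j ≤ k := by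
    intro i k
    apply exists_threshold
    intro j j' hjj hj' hk
    by_cases h0 : F.T i j = 0
    · omega
    · have h1 := (hsupp i j).1 h0
      have h2 : F.T i j' ≠ 0 := (hsupp i j').2 ⟨hj', by omega⟩
      exact (F.rows_weak i j j' hjj h0 h2).trans hk
  choose M hM using hM
  have hmono : ∀ i k, M i k ≤ M i (k + 1) := by
    intro i k
    apply le_of_forall_lt
    intro j hj
    rw [hM] at *
    exact ⟨hj.1, by omega⟩
  have hle : ∀ i k, M i k ≤ lam.rowLen i := by
    intro i k
    apply le_of_forall_lt
    intro j hj
    exact ((hM _ _ _).1 hj).1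
  have hT : ∀ i j k, F.T i j = k + 1 ↔ M i k ≤ j ∧ j < M i (k + 1) := by
    intro i j k
    rw [← not_lt, hM, hM]
    have := hsupp i j
    constructor
    · intro h
      have := this.1 (by omega)
      omega
    · intro h
      omega
  refine ⟨fun i k => (M i k : ℤ), ?_, ?_, ?_, ?_, ?_, ?_⟩
  · intro i
    simp only [rl]
    congr 1
    apply eq_of_forall_lt_iff
    intro j
    rw [hM]
    have := hsupp i j
    have := hsub i
    constructor
    · intro h
      by_contra hc
      have : F.T i j ≠ 0 := (hsupp i j).2 ⟨h.1, hc⟩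
      omega
    · intro h
      refine ⟨by omega, ?_⟩
      by_contra hc
      exact ((hsupp i j).1 (by omega)).2 h
  · intro i k
    exact_mod_cast hmono i k
  · intro i k
    have : M (i + 1) (k + 1) ≤ M i k := by
      apply le_of_forall_lt
      intro j hj
      rw [hM] at *
      have h1 := lam.rowLen_anti i (i + 1) (by omega)
      have h2 := μ.rowLen_anti i (i + 1) (by omega)
      refine ⟨by omega, ?_⟩
      by_cases h0 : F.T i j = 0
      · omega
      · have h3 := (hsupp i j).1 h0
        have h4 : F.T (i + 1) j ≠ 0 := (hsupp (i + 1) j).2 ⟨hj.1, by omega⟩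
        have := F.cols_strict i (i + 1) j (by omega) h0 h4
        omega
    exact_mod_cast this
  · refine ⟨ν.colLen 0, fun i k hk => ?_⟩
    simp only [rl]
    congr 1
    apply eq_of_forall_lt_iff
    intro j
    rw [hM]
    have := F.le_colLen i j
    constructor
    · exact fun h => h.1
    · exact fun h => ⟨h, by omega⟩
  · intro n k
    rw [← card_fiber F.T M (n + 1) (k + 1) (fun i j => hT i j _) (fun i => hmono i _),
      ← card_fiber F.T M n k (fun i j => hT i j _) (fun i => hmono i _)]
    have hb := F.ballot n (M n (k + 1)) k
    have h1 : Nat.card {p : ℕ × ℕ // p.1 < n + 1 ∧ F.T p.1 p.2 = k + 1 + 1} ≤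
        Nat.card {p : ℕ × ℕ // (p.1 < n ∨ (p.1 = n ∧ M n (k + 1) ≤ p.2)) ∧ F.T p.1 p.2 = k + 2} := by
      refine Nat.card_mono (s := {p : ℕ × ℕ | p.1 < n + 1 ∧ F.T p.1 p.2 = k + 1 + 1})
        (t := {p : ℕ × ℕ | (p.1 < n ∨ (p.1 = n ∧ M n (k + 1) ≤ p.2)) ∧ F.T p.1 p.2 = k + 2})
        ((F.finite_set (k + 1)).subset fun p hp => hp.2) ?_
      rintro ⟨i, j⟩ ⟨hi, hj⟩
      simp only at hi hj
      refine ⟨?_, hj⟩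
      rcases Nat.lt_succ_iff_lt_or_eq.1 hi with hi | rfl
      · exact Or.inl hi
      · exact Or.inr ⟨rfl, ((hT i j _).1 hj).1⟩
    have h2 : Nat.card {p : ℕ × ℕ // (p.1 < n ∨ (p.1 = n ∧ M n (k + 1) ≤ p.2)) ∧
        F.T p.1 p.2 = k + 1} ≤ Nat.card {p : ℕ × ℕ // p.1 < n ∧ F.T p.1 p.2 = k + 1} := by
      refine Nat.card_mono
        (s := {p : ℕ × ℕ | (p.1 < n ∨ (p.1 = n ∧ M n (k + 1) ≤ p.2)) ∧ F.T p.1 p.2 = k + 1})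
        (t := {p : ℕ × ℕ | p.1 < n ∧ F.T p.1 p.2 = k + 1})
        ((F.finite_set k).subset fun p hp => hp.2) ?_
      rintro ⟨i, j⟩ ⟨hi, hj⟩
      simp only at hi hj
      refine ⟨?_, hj⟩
      rcases hi with hi | ⟨rfl, hi⟩
      · exact hi
      · have := ((hT i j _).1 hj).2
        omega
    exact_mod_cast h1.trans (hb.trans h2)
  · refine ⟨lam.colLen 0, fun n k hn => ?_⟩
    rw [← card_fiber F.T M n k (fun i j => hT i j _) (fun i => hmono i _), rl, ← F.content k]
    congr 1
    refine Nat.card_congr (Equiv.subtypeEquivRight ?_)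
    rintro ⟨i, j⟩
    refine ⟨fun h => h.2, fun h => ⟨?_, h⟩⟩
    simp only at h ⊢
    have := ((hsupp i j).1 (by omega)).1
    have := lt_colLen_of_rowLen (μ := lam) (i := i) (by omega)
    omega

lemma LRD.toFilling {μ ν lam : YoungDiagram} {L} (h : LRD (rl μ) (rl ν) (rl lam) L) :
    Nonempty (LRFilling μ ν lam) := by
  obtain ⟨K, hK⟩ := h.top
  obtain ⟨R, hR⟩ := h.cont
  have hnn : ∀ i k, 0 ≤ L i k := by
    intro i k
    have := h.mono' i (Nat.zero_le k)
    rw [h.zero, rl] at this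
    omega
  obtain ⟨M, hML⟩ : ∃ M : ℕ → ℕ → ℕ, ∀ i k, (M i k : ℤ) = L i k :=
    ⟨fun i k => (L i k).toNat, fun i k => Int.toNat_of_nonneg (hnn i k)⟩
  have hMz : ∀ i, M i 0 = μ.rowLen i := by
    intro i
    have := h.zero i
    rw [← hML, rl] at this
    exact_mod_cast this
  have hMmono : ∀ i {k k'}, k ≤ k' → M i k ≤ M i k' := by
    intro i k k' hk
    have := h.mono' i hk
    rw [← hML, ← hML] at this
    exact_mod_cast this
  have hMtop : ∀ i k, K ≤ k → M i k = lam.rowLen i := by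
    intro i k hk
    have := hK i k hk
    rw [← hML, rl] at this
    exact_mod_cast this
  have hMle : ∀ i k, M i k ≤ lam.rowLen i := by
    intro i k
    rw [← hMtop i (max K k) (le_max_left _ _)]
    exact hMmono i (le_max_right _ _)
  have hMint : ∀ i k, M (i + 1) (k + 1) ≤ M i k := by
    intro i k
    have := h.inter i k
    rw [← hML, ← hML] at this
    exact_mod_cast this
  have hManti : ∀ k i i', i ≤ i' → M i' k ≤ M i k := by
    intro k i i' hi
    exact antitone_nat_of_succ_le (f := fun i => M i k)
      (fun i => (hMmono _ (Nat.le_succ k)).trans (hMint i k)) hi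
  have hMint' : ∀ k i i', i < i' → M i' (k + 1) ≤ M i k := by
    intro k i i' hi
    exact (hManti (k + 1) (i + 1) i' hi).trans (hMint i k)
  have hT : ∀ i j, ∃ t, (j < lam.rowLen i → ∀ k, t ≤ k ↔ j < M i k) ∧
      (¬ j < lam.rowLen i → t = 0) := by
    intro i j
    classical
    by_cases hj : j < lam.rowLen i
    · have hex : ∃ k, j < M i k := ⟨K, by rwa [hMtop i K le_rfl]⟩
      refine ⟨Nat.find hex, fun _ k => ⟨fun hk => ?_, fun hk => Nat.find_min' hex hk⟩,
        fun hc => absurd hj hc⟩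
      exact (Nat.find_spec hex).trans_le (hMmono i hk)
    · exact ⟨0, fun hc => absurd hc hj, fun _ => rfl⟩
  choose T hT1 hT2 using hT
  have hTk : ∀ k i j, T i j = k + 1 ↔ M i k ≤ j ∧ j < M i (k + 1) := by
    intro k i j
    by_cases hj : j < lam.rowLen i
    · rw [← hT1 i j hj (k + 1), ← not_lt, ← hT1 i j hj k]
      omega
    · have := hT2 i j hj
      have := hMle i (k + 1)
      omega
  have hlt : ∀ i j, T i j ≠ 0 → j < lam.rowLen i := by
    intro i j h0
    by_contra hc
    exact h0 (hT2 i j hc)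
  have hfin : ∀ k, {p : ℕ × ℕ | T p.1 p.2 = k + 1}.Finite := by
    intro k
    refine lam.cells.finite_toSet.subset ?_
    rintro ⟨i, j⟩ hh
    have h' : T i j = k + 1 := hh
    exact (YoungDiagram.mem_cells _).2 (YoungDiagram.mem_iff_lt_rowLen.2 (hlt i j (by omega)))
  have hcard : ∀ n k, ((Nat.card {p : ℕ × ℕ // p.1 < n ∧ T p.1 p.2 = k + 1} : ℕ) : ℤ)
      = NN L n k := by
    intro n k
    rw [card_fiber T M n k (hTk k) (fun i => hMmono i (Nat.le_succ k))]
    simp only [hML]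
  refine ⟨⟨?_, T, ?_, ?_, ?_, ?_, ?_⟩⟩
  · rintro ⟨i, j⟩ hij
    rw [YoungDiagram.mem_iff_lt_rowLen] at *
    have := hMle i 0
    rw [hMz] at this
    omega
  · intro i j
    rw [YoungDiagram.mem_iff_lt_rowLen, YoungDiagram.mem_iff_lt_rowLen, ← hMz]
    constructor
    · intro h0
      have hj := hlt i j h0
      rw [← hT1 i j hj 0]
      exact ⟨hj, by omega⟩
    · rintro ⟨hj, h0⟩
      rw [← hT1 i j hj 0] at h0
      omega
  · intro i j₁ j₂ hj h1 h2
    rw [hT1 i j₁ (hlt _ _ h1)]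
    have := (hT1 i j₂ (hlt _ _ h2) _).1 le_rfl
    omega
  · intro i₁ i₂ j hi h1 h2
    obtain ⟨k, hk⟩ : ∃ k, T i₂ j = k + 1 := ⟨T i₂ j - 1, by omega⟩
    have e1 := ((hTk k i₂ j).1 hk).2
    have e2 := hMint' k i₁ i₂ hi
    have := (hT1 i₁ j (hlt _ _ h1) k).2 (by omega)
    omega
  · intro k
    have h1 := hcard (max R (lam.colLen 0)) k
    rw [hR _ k (le_max_left _ _), rl] at h1
    have h2 : Nat.card {p : ℕ × ℕ // p.1 < max R (lam.colLen 0) ∧ T p.1 p.2 = k + 1}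
      = ν.rowLen k := by exact_mod_cast h1
    rw [← h2]
    refine Nat.card_congr (Equiv.subtypeEquivRight ?_)
    rintro ⟨i, j⟩
    refine ⟨fun hh => ⟨?_, hh⟩, fun hh => hh.2⟩
    simp only at hh ⊢
    have := hlt i j (by omega)
    have := lt_colLen_of_rowLen (μ := lam) (i := i) (by omega)
    omega
  · intro i j k
    have hb := h.bal i k
    rw [← hcard, ← hcard] at hb
    have hb' : Nat.card {p : ℕ × ℕ // p.1 < i + 1 ∧ T p.1 p.2 = k + 1 + 1} ≤
      Nat.card {p : ℕ × ℕ // p.1 < i ∧ T p.1 p.2 = k + 1} := by exact_mod_cast hb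
    refine le_trans ?_ (hb'.trans ?_)
    · refine Nat.card_mono
        (s := {p : ℕ × ℕ | (p.1 < i ∨ (p.1 = i ∧ j ≤ p.2)) ∧ T p.1 p.2 = k + 2})
        (t := {p : ℕ × ℕ | p.1 < i + 1 ∧ T p.1 p.2 = k + 1 + 1})
        ((hfin (k + 1)).subset fun p hp => hp.2) ?_
      rintro ⟨i', j'⟩ ⟨hi, hj⟩
      refine ⟨?_, hj⟩
      simp only at hi ⊢
      omega
    · refine Nat.card_mono
        (s := {p : ℕ × ℕ | p.1 < i ∧ T p.1 p.2 = k + 1})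
        (t := {p : ℕ × ℕ | (p.1 < i ∨ (p.1 = i ∧ j ≤ p.2)) ∧ T p.1 p.2 = k + 1})
        ((hfin k).subset fun p hp => hp.2) ?_
      rintro ⟨i', j'⟩ ⟨hi, hj⟩
      exact ⟨Or.inl hi, hj⟩

lemma LRD.l_anti {a c l L} (h : LRD a c l L) (i : ℕ) : l (i + 1) ≤ l i := by
  obtain ⟨K, hK⟩ := h.top
  rw [← hK (i + 1) (K + 1) (by omega), ← hK i K le_rfl]
  exact h.inter i K

lemma LRD.a_anti {a c l L} (h : LRD a c l L) (i : ℕ) : a (i + 1) ≤ a i := by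
  rw [← h.zero, ← h.zero]
  exact (h.mono _ _).trans (h.inter _ _)

lemma LRD.c_anti {a c l L} (h : LRD a c l L) (k : ℕ) : c (k + 1) ≤ c k := by
  obtain ⟨R, hR⟩ := h.cont
  rw [← hR (R + 1) (k + 1) (by omega), ← hR R k le_rfl]
  exact h.bal R k

lemma rl_eventually (μ : YoungDiagram) : ∃ R, ∀ i, R ≤ i → rl μ i = 0 :=
  ⟨μ.colLen 0, fun i hi => by rw [rl, rowLen_zero_of_le μ hi]; rfl⟩

lemma exists_add (μ : YoungDiagram) (e : ℕ) (h : ∀ i, (rl μ + dlt e) (i + 1) ≤ (rl μ + dlt e) i) :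
    ∃ μ', rl μ' = rl μ + dlt e := by
  obtain ⟨R, hR⟩ := rl_eventually μ
  refine exists_diagram _ h (max R (e + 1)) fun i hi => ?_
  have h1 := hR i (le_trans (le_max_left _ _) hi)
  have h2 := le_trans (le_max_right _ _) hi
  rw [Pi.add_apply, h1, dlt, if_neg (by omega)]
  rfl

lemma exists_sub (μ : YoungDiagram) (e : ℕ) (h : ∀ i, (rl μ - dlt e) (i + 1) ≤ (rl μ - dlt e) i) :
    ∃ μ', rl μ' = rl μ - dlt e := by
  obtain ⟨R, hR⟩ := rl_eventually μ
  refine exists_diagram _ h (max R (e + 1)) fun i hi => ?_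
  have h1 := hR i (le_trans (le_max_left _ _) hi)
  have h2 := le_trans (le_max_right _ _) hi
  rw [Pi.sub_apply, h1, dlt, if_neg (by omega)]
  rfl

lemma add_box {μ μ' : YoungDiagram} {e : ℕ} (h : rl μ' = rl μ + dlt e) :
    μ ≤ μ' ∧ μ'.card = μ.card + 1 := by
  have hc : μ'.cells = insert (e, μ.rowLen e) μ.cells := by
    ext ⟨i, j⟩
    rw [Finset.mem_insert, YoungDiagram.mem_cells, YoungDiagram.mem_cells,
      YoungDiagram.mem_iff_lt_rowLen, YoungDiagram.mem_iff_lt_rowLen, Prod.mk.injEq]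
    have h1 := congrFun h i
    simp only [rl, Pi.add_apply, dlt] at h1
    split_ifs at h1 with hi
    · subst hi; omega
    · omega
  constructor
  · rw [← YoungDiagram.cells_subset_iff, hc]
    exact Finset.subset_insert _ _
  · rw [YoungDiagram.card, hc, Finset.card_insert_of_notMem]
    rw [YoungDiagram.mem_cells, YoungDiagram.mem_iff_lt_rowLen]
    omega

lemma card_eq_sum_rowLen (μ : YoungDiagram) (B : ℕ) (hB : μ.colLen 0 ≤ B) :
    μ.card = ∑ k ∈ Finset.range B, μ.rowLen k := by
  rw [YoungDiagram.card, Finset.card_eq_sum_card_fiberwise (f := Prod.fst) (t := Finset.range B)]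
  · refine Finset.sum_congr rfl fun k _ => ?_
    rw [YoungDiagram.rowLen_eq_card]
    rfl
  · rintro ⟨i, j⟩ hij
    rw [Finset.mem_coe, YoungDiagram.mem_cells, YoungDiagram.mem_iff_lt_rowLen] at hij
    have := lt_colLen_of_rowLen (μ := μ) (i := i) (by omega)
    simp only [Finset.coe_range, Set.mem_Iio]
    omega

lemma LRFilling.card_eq {μ ν lam : YoungDiagram} (F : LRFilling μ ν lam) :
    lam.card = μ.card + ν.card := by
  have h1 : (lam.cells \ μ.cells).card = ν.card := by
    rw [card_eq_sum_rowLen ν _ le_rfl, Finset.card_eq_sum_card_fiberwise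
      (f := fun p => F.T p.1 p.2 - 1) (t := Finset.range (ν.colLen 0))]
    · refine Finset.sum_congr rfl fun k _ => ?_
      rw [← F.content k, Nat.subtype_card]
      rintro ⟨i, j⟩
      have := F.supp i j
      simp only [Finset.mem_filter, Finset.mem_sdiff, YoungDiagram.mem_cells, ← this]
      omega
    · rintro ⟨i, j⟩ hij
      have := F.supp i j
      simp only [Finset.coe_sdiff, Set.mem_sdiff, Finset.mem_coe, YoungDiagram.mem_cells,
        ← this] at hij
      have := F.le_colLen i j
      simp only [Finset.coe_range, Set.mem_Iio]
      omega
  have h2 := Finset.card_sdiff_add_card_eq_card (YoungDiagram.cells_subset_iff.2 F.sub)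
  rw [h1] at h2
  simp only [YoungDiagram.card] at *
  omega

/-! ### Finiteness -/

lemma finite_Iic (μ : YoungDiagram) : Finite {α : YoungDiagram // α ≤ μ} := by
  refine Finite.of_injective
    (β := {s : Finset (ℕ × ℕ) // s ∈ μ.cells.powerset})
    (fun α => ⟨α.1.cells, Finset.mem_powerset.2 (YoungDiagram.cells_subset_iff.2 α.2)⟩) ?_
  rintro ⟨α, hα⟩ ⟨β, hβ⟩ h
  simp only [Subtype.mk.injEq] at h ⊢
  exact YoungDiagram.ext h

lemma LRFilling.finite (μ ν lam : YoungDiagram) : Finite (LRFilling μ ν lam) := by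
  refine Finite.of_injective (β := {p : ℕ × ℕ // p ∈ lam.cells} → Fin (ν.colLen 0 + 1))
    (fun F p => ⟨F.T p.1.1 p.1.2, Nat.lt_succ_of_le (F.le_colLen _ _)⟩) ?_
  intro F G h
  have hT : F.T = G.T := by
    funext i j
    by_cases hij : (i, j) ∈ lam
    · have := congrFun h ⟨(i, j), (YoungDiagram.mem_cells _).2 hij⟩
      simpa using this
    · have h1 : F.T i j = 0 := by
        by_contra hc; exact hij ((F.supp i j).1 hc).1
      have h2 : G.T i j = 0 := by
        by_contra hc; exact hij ((G.supp i j).1 hc).1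
      rw [h1, h2]
  cases F; cases G
  simp only at hT
  subst hT
  rfl

lemma finite_card_le (N : ℕ) : Finite {γ : YoungDiagram // γ.card ≤ N} := by
  refine Finite.of_injective
    (β := {s : Finset (ℕ × ℕ) // s ∈ (Finset.range N ×ˢ Finset.range N).powerset})
    (fun γ => ⟨γ.1.cells, ?_⟩) ?_
  · obtain ⟨γ, hγ⟩ := γ
    rw [Finset.mem_powerset]
    rintro ⟨i, j⟩ hij
    rw [YoungDiagram.mem_cells] at hij
    have h1 : i < γ.colLen j := YoungDiagram.mem_iff_lt_colLen.1 hij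
    have h2 : j < γ.rowLen i := YoungDiagram.mem_iff_lt_rowLen.1 hij
    have h3 : γ.colLen j ≤ γ.card := by
      rw [YoungDiagram.colLen_eq_card]; exact Finset.card_filter_le _ _
    have h4 : γ.rowLen i ≤ γ.card := by
      rw [YoungDiagram.rowLen_eq_card]; exact Finset.card_filter_le _ _
    simp only [Finset.mem_product, Finset.mem_range]
    omega
  · rintro ⟨α, hα⟩ ⟨β, hβ⟩ h
    simp only [Subtype.mk.injEq] at h ⊢
    exact YoungDiagram.ext h

lemma NL_pos {μ ν lam α β γ : YoungDiagram} (F : LRFilling α β μ) (G : LRFilling α γ ν)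
    (H : LRFilling β γ lam) : 0 < NL μ ν lam := by
  unfold NL
  have := finite_Iic μ
  have := finite_Iic lam
  have := finite_card_le lam.card
  have := LRFilling.finite
  have : Finite (Σ α β γ : YoungDiagram,
      (LRFilling α β μ × LRFilling α γ ν × LRFilling β γ lam)) := by
    refine Finite.of_surjective
      (α := Σ (α : {α : YoungDiagram // α ≤ μ}) (β : {β : YoungDiagram // β ≤ lam})
        (γ : {γ : YoungDiagram // γ.card ≤ lam.card}),
        (LRFilling α.1 β.1 μ × LRFilling α.1 γ.1 ν × LRFilling β.1 γ.1 lam))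
      (fun x => ⟨x.1.1, x.2.1.1, x.2.2.1.1, x.2.2.2⟩) ?_
    rintro ⟨α, β, γ, F, G, H⟩
    exact ⟨⟨⟨α, F.sub⟩, ⟨β, H.sub⟩, ⟨γ, by have := H.card_eq; omega⟩, F, G, H⟩, rfl⟩
  have : Nonempty (Σ α β γ : YoungDiagram,
      (LRFilling α β μ × LRFilling α γ ν × LRFilling β γ lam)) := ⟨⟨α, β, γ, F, G, H⟩⟩
  exact Nat.card_pos

lemma exists_corner (α : YoungDiagram) (h : 0 < α.card) : ∃ r, rl α (r + 1) < rl α r := by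
  by_contra hc
  push Not at hc
  have hm : Monotone (rl α) := monotone_nat_of_le_succ hc
  obtain ⟨R, hR⟩ := rl_eventually α
  have hz : ∀ i, α.rowLen i = 0 := by
    intro i
    have h1 := hm (show i ≤ max R i from le_max_right _ _)
    rw [hR _ (le_max_left _ _), rl] at h1
    omega
  rw [card_eq_sum_rowLen α _ le_rfl] at h
  simp [hz] at h

lemma lt_of_anti_add {a : ℕ → ℤ} {r : ℕ} (h : ∀ i, (a + dlt r) (i + 1) ≤ (a + dlt r) i) :
    ∀ i, i + 1 = r → a r < a i := by
  rintro i rfl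
  have := h i
  simp only [Pi.add_apply, dlt] at this
  rw [if_pos trivial, if_neg (by omega)] at this
  omega

theorem NL_up (μ ν lam : YoungDiagram) (h : 0 < NL μ ν lam)
    (hlt : lam.card < μ.card + ν.card) :
    ∃ lam'' : YoungDiagram, lam ≤ lam'' ∧ lam''.card = lam.card + 2 ∧
      0 < NL μ ν lam'' := by
  obtain ⟨⟨⟨α, β, γ, F, G, H⟩⟩, _⟩ := Nat.card_pos_iff.1 h
  have c1 := F.card_eq
  have c2 := G.card_eq
  have c3 := H.card_eq
  obtain ⟨r, hr⟩ := exists_corner α (by omega)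
  obtain ⟨L1, h1⟩ := F.toLRD
  obtain ⟨L2, h2⟩ := G.toLRD
  obtain ⟨L3, h3⟩ := H.toLRD
  have hnn : ∀ i, 0 ≤ rl α i := fun i => Int.natCast_nonneg _
  obtain ⟨L1', e1, h1'⟩ := down1 h1 r hr (rl_eventually μ) hnn
  obtain ⟨L2', e2, h2'⟩ := down1 h2 r hr (rl_eventually ν) hnn
  obtain ⟨α', hα'⟩ := exists_sub α r h1'.a_anti
  obtain ⟨β', hβ'⟩ := exists_add β e1 h1'.c_anti
  obtain ⟨γ', hγ'⟩ := exists_add γ e2 h2'.c_anti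
  obtain ⟨L4, e4, h4⟩ := up2 h3 e1 (lt_of_anti_add h1'.c_anti)
  obtain ⟨lam', hlam'⟩ := exists_add lam e4 h4.l_anti
  obtain ⟨L5, e5, h5⟩ := up3 h4 e2 (lt_of_anti_add h2'.c_anti)
  rw [← hlam'] at h5
  obtain ⟨lam'', hlam''⟩ := exists_add lam' e5 h5.l_anti
  rw [← hα', ← hβ'] at h1'
  rw [← hα', ← hγ'] at h2'
  rw [← hlam'', ← hβ', ← hγ'] at h5
  obtain ⟨F'⟩ := h1'.toFilling
  obtain ⟨G'⟩ := h2'.toFilling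
  obtain ⟨H'⟩ := h5.toFilling
  obtain ⟨b1, b2⟩ := add_box hlam'
  obtain ⟨b3, b4⟩ := add_box hlam''
  exact ⟨lam'', b1.trans b3, by omega, NL_pos F' G' H'⟩
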